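/- arXiv:1605.04972 — 5 statements merged into one kernel-verified Lean document; each statement's English description precedes it below -/
import Mathlib

section
/- Let f : ℕ → ℕ be monotone nondecreasing and let (P_n)_{n∈ℕ} be a sequence of nonzero formal Laurent series over ℤ. Then the sequence (P_n) stabilizes with rate f if and only if P_n ≐_{f(n)} P_{n+1} for all n ∈ ℕ. -/
noncomputable section

/-- `a_i(P)`: the coefficient of `q^(ord(P)+i)` in the Laurent series `P`. -/
def lowCoeff (P : LaurentSeries ℤ) (i : ℕ) : ℤ := P.coeff (P.order + i)

/-- `P ≐_n Q`: the first `n` lowest coefficients of `P` and `Q` agree up to an overall sign. -/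
def NEquiv (n : ℕ) (P Q : LaurentSeries ℤ) : Prop :=
  ∃ ε : ℤ, (ε = 1 ∨ ε = -1) ∧ ∀ i : ℕ, i < n → lowCoeff P i = ε * lowCoeff Q i

/-- A sequence of nonzero Laurent series stabilizes with rate `f` if there is a nonzero
Laurent series `T` (a tail) with `T ≐_{f(n)} P_n` for all `n`. -/
def Stabilizes (P : ℕ → LaurentSeries ℤ) (f : ℕ → ℕ) : Prop :=
  ∃ T : LaurentSeries ℤ, T ≠ 0 ∧ ∀ n : ℕ, NEquiv (f n) T (P n)

/-- Every integer sequence with nonzero first term is the sequence of lowest coefficients of some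
nonzero Laurent series. -/
lemma exists_lowCoeff_eq (t : ℕ → ℤ) (ht : t 0 ≠ 0) :
    ∃ T : LaurentSeries ℤ, T ≠ 0 ∧ ∀ i : ℕ, lowCoeff T i = t i := by
  set T : LaurentSeries ℤ := (PowerSeries.mk t : LaurentSeries ℤ) with hT
  have hcoeff (i : ℕ) : T.coeff i = t i := by
    rw [hT, LaurentSeries.coeff_coe_powerSeries, PowerSeries.coeff_mk]
  have hzero : T.coeff 0 ≠ 0 := by simpa using (hcoeff 0).trans_ne ht
  have hne : T ≠ 0 := HahnSeries.ne_zero_of_coeff_ne_zero hzero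
  have horder : T.order = 0 := by
    refine le_antisymm (HahnSeries.order_le_of_coeff_ne_zero hzero)
      ((HahnSeries.le_order_iff_forall hne).2 fun j hj => ?_)
    rw [hT, PowerSeries.coeff_coe, if_pos hj]
  exact ⟨T, hne, fun i => by rw [lowCoeff, horder, zero_add, hcoeff]⟩

lemma lowCoeff_zero_ne_zero {P : LaurentSeries ℤ} (hP : P ≠ 0) : lowCoeff P 0 ≠ 0 := by
  simpa [lowCoeff] using hP

lemma NEquiv.mono {m n : ℕ} {P Q : LaurentSeries ℤ} (h : NEquiv n P Q) (hmn : m ≤ n) :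
    NEquiv m P Q := by
  obtain ⟨ε, hε, h⟩ := h
  exact ⟨ε, hε, fun i hi => h i (hi.trans_le hmn)⟩

lemma NEquiv.symm {n : ℕ} {P Q : LaurentSeries ℤ} (h : NEquiv n P Q) : NEquiv n Q P := by
  obtain ⟨ε, rfl | rfl, h⟩ := h
  · exact ⟨1, Or.inl rfl, fun i hi => by simp [h i hi]⟩
  · exact ⟨-1, Or.inr rfl, fun i hi => by simp [h i hi]⟩

lemma NEquiv.trans {n : ℕ} {P Q R : LaurentSeries ℤ} (hPQ : NEquiv n P Q) (hQR : NEquiv n Q R) :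
    NEquiv n P R := by
  obtain ⟨ε, hε, hPQ⟩ := hPQ
  obtain ⟨δ, hδ, hQR⟩ := hQR
  refine ⟨ε * δ, ?_, fun i hi => by rw [hPQ i hi, hQR i hi, mul_assoc]⟩
  rcases hε with rfl | rfl <;> rcases hδ with rfl | rfl <;> simp

/-- If consecutive terms agree below `f n`, then there is a limit sequence agreeing with the `n`-th
term below `f n`; its values outside all these ranges can be prescribed by `d`. -/
lemma exists_limit_of_consecutive {α : Type*} {f : ℕ → ℕ} (hf : Monotone f) (b : ℕ → ℕ → α)
    (hb : ∀ n i, i < f n → b n i = b (n + 1) i) (d : ℕ → α) :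
    ∃ t : ℕ → α, (∀ n i, i < f n → t i = b n i) ∧ ∀ i, (∀ n, f n ≤ i) → t i = d i := by
  have hle {m n i : ℕ} (hmn : m ≤ n) (hi : i < f m) : b m i = b n i := by
    induction n, hmn using Nat.le_induction with
    | base => rfl
    | succ n hmn ih => exact ih.trans (hb n i (hi.trans_le (hf hmn)))
  have key (i : ℕ) : ∃ x, (∀ n, i < f n → x = b n i) ∧ ((∀ n, f n ≤ i) → x = d i) := by
    by_cases h : ∃ m, i < f m
    · obtain ⟨m, hm⟩ := h
      refine ⟨b m i, fun n hn => ?_, fun h => absurd hm (h m).not_gt⟩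
      rcases le_total m n with hmn | hnm
      · exact hle hmn hm
      · exact (hle hnm hn).symm
    · exact ⟨d i, fun n hn => absurd ⟨n, hn⟩ h, fun _ => rfl⟩
  choose t ht using key
  exact ⟨t, fun n i => (ht i).1 n, fun i => (ht i).2⟩

/-- A sequence stabilizes with nondecreasing rate `f` iff `P_n ≐_{f(n)} P_{n+1}` for all `n`. -/
theorem stabilizes_iff_consecutive (f : ℕ → ℕ) (hf : Monotone f)
    (P : ℕ → LaurentSeries ℤ) (hP : ∀ n : ℕ, P n ≠ 0) :
    Stabilizes P f ↔ ∀ n : ℕ, NEquiv (f n) (P n) (P (n + 1)) := by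
  constructor
  · rintro ⟨T, -, hT⟩ n
    exact (hT n).symm.trans ((hT (n + 1)).mono (hf n.le_succ))
  · intro h
    choose ε hε h using h
    let s (n : ℕ) : ℤ := ∏ k ∈ Finset.range n, ε k
    have hs (n : ℕ) : s n = 1 ∨ s n = -1 :=
      Int.isUnit_iff.1 (IsUnit.prod_iff.2 fun k _ => Int.isUnit_iff.2 (hε k))
    obtain ⟨t, ht, ht'⟩ := exists_limit_of_consecutive hf (fun n i => s n * lowCoeff (P n) i)
      (fun n i hi => by simp only [s, Finset.prod_range_succ, h n i hi, mul_assoc]) fun _ => 1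
    have ht0 : t 0 ≠ 0 := by
      by_cases h0 : ∃ n, 0 < f n
      · obtain ⟨n, hn⟩ := h0
        rw [ht n 0 hn]
        refine mul_ne_zero ?_ (lowCoeff_zero_ne_zero (hP n))
        rcases hs n with hn | hn <;> simp [hn]
      · rw [ht' 0 fun n => not_lt.1 fun hn => h0 ⟨n, hn⟩]
        exact one_ne_zero
    obtain ⟨T, hT, hTt⟩ := exists_lowCoeff_eq t ht0
    exact ⟨T, hT, fun n => ⟨s n, hs n, fun i hi => by rw [hTt, ht n i hi]⟩⟩

end
end

section
/- For integers 0 ≤ j ≤ n, the rational function Δ_{2j}/θ(n,n,2j) is nonzero and its order at A = 0 equals 2(n − j), i.e., m(Δ_{2j}/θ(n,n,2j)) = 2n − 2j. -/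
noncomputable section

/-- The variable `A` of the field `ℚ(A)` of rational functions. -/
def Aq : RatFunc ℚ := RatFunc.X

/-- The q-Pochhammer symbol `(A^4; A^4)_m` in `ℚ(A)`. -/
def poch (m : ℕ) : RatFunc ℚ := ∏ j ∈ Finset.range m, (1 - Aq ^ 4 * (Aq ^ 4) ^ j)

/-- `Δ_m = (-1)^m (A^{2(m+1)} - A^{-2(m+1)})/(A^2 - A^{-2})`. -/
def Delta (m : ℕ) : RatFunc ℚ :=
  (-1) ^ m * (Aq ^ (2 * ((m : ℤ) + 1)) - Aq ^ (-(2 * ((m : ℤ) + 1)))) /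
    (Aq ^ (2 : ℤ) - Aq ^ (-2 : ℤ))

/-- The evaluation `θ(a,b,c)` of the theta graph, with internal colors
`x=(a+b-c)/2`, `y=(a+c-b)/2`, `z=(b+c-a)/2`. -/
def theta (a b c : ℕ) : RatFunc ℚ :=
  (-1 : RatFunc ℚ) ^ ((a + b - c) / 2 + (a + c - b) / 2 + (b + c - a) / 2) *
    Aq ^ (-(2 * ((((a + b - c) / 2 + (a + c - b) / 2 + (b + c - a) / 2 : ℕ)) : ℤ))) *
    (poch ((a + b - c) / 2) * poch ((a + c - b) / 2) * poch ((b + c - a) / 2) *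
      poch ((a + b - c) / 2 + (a + c - b) / 2 + (b + c - a) / 2 + 1)) /
    ((1 - Aq ^ 4) * poch ((a + b - c) / 2 + (a + c - b) / 2) *
      poch ((a + c - b) / 2 + (b + c - a) / 2) * poch ((a + b - c) / 2 + (b + c - a) / 2))

/-- `μ_{2j}^{n,n} = (-1)^{n-j} A^{2n-2j+n²-2j²}`. -/
def mu (n j : ℕ) : RatFunc ℚ :=
  (-1 : RatFunc ℚ) ^ (n - j) * Aq ^ (2 * (n : ℤ) - 2 * j + (n : ℤ) ^ 2 - 2 * (j : ℤ) ^ 2)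

/-- `C_{n,i} = A^{n²+2i²-4in} (A^4;A^4)_n / ((A^4;A^4)_i (A^4;A^4)_{n-i})`. -/
def Cnn (n i : ℕ) : RatFunc ℚ :=
  Aq ^ ((n : ℤ) ^ 2 + 2 * (i : ℤ) ^ 2 - 4 * (i : ℤ) * n) * poch n / (poch i * poch (n - i))

/-- `m(f)`: the order of `f` at `A = 0`, i.e. the order of `f` as a formal Laurent series. -/
def ordA (f : RatFunc ℚ) : ℤ := (f : LaurentSeries ℚ).order

/-- `f` is nonzero and has order `k` at `A = 0`. -/
def HasOrdA (f : RatFunc ℚ) (k : ℤ) : Prop := f ≠ 0 ∧ ordA f = k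

namespace HasOrdA

variable {f g : RatFunc ℚ} {k l : ℤ}

theorem iff_orderTop : HasOrdA f k ↔ (f : LaurentSeries ℚ).orderTop = k := by
  unfold HasOrdA ordA
  have h0 : f ≠ 0 ↔ (f : LaurentSeries ℚ) ≠ 0 := by simp
  rw [h0]
  constructor
  · rintro ⟨hf, rfl⟩
    exact (HahnSeries.order_eq_orderTop_of_ne_zero hf).symm
  · intro h
    have hf : (f : LaurentSeries ℚ) ≠ 0 := fun h0 => by simp [h0] at h
    exact ⟨hf, WithTop.coe_injective ((HahnSeries.order_eq_orderTop_of_ne_zero hf).trans h)⟩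

theorem one : HasOrdA 1 0 := by
  simp [iff_orderTop]

theorem mul (hf : HasOrdA f k) (hg : HasOrdA g l) : HasOrdA (f * g) (k + l) := by
  obtain ⟨hf, rfl⟩ := hf
  obtain ⟨hg, rfl⟩ := hg
  refine ⟨mul_ne_zero hf hg, ?_⟩
  unfold ordA
  rw [map_mul, HahnSeries.order_mul] <;> simpa

theorem inv (hf : HasOrdA f k) : HasOrdA f⁻¹ (-k) := by
  have hinv : HasOrdA f⁻¹ (ordA f⁻¹) := ⟨inv_ne_zero hf.1, rfl⟩
  have h := (hf.mul hinv).2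
  rw [mul_inv_cancel₀ hf.1, one.2] at h
  exact ⟨hinv.1, by lia⟩

theorem div (hf : HasOrdA f k) (hg : HasOrdA g l) : HasOrdA (f / g) (k - l) := by
  simpa only [div_eq_mul_inv, sub_eq_add_neg] using hf.mul hg.inv

theorem neg (hf : HasOrdA f k) : HasOrdA (-f) k := by
  rw [iff_orderTop] at hf ⊢
  rw [map_neg, HahnSeries.orderTop_neg, hf]

theorem sub_of_lt (hf : HasOrdA f k) (hg : HasOrdA g l) (h : k < l) : HasOrdA (f - g) k := by
  rw [iff_orderTop] at hf hg ⊢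
  rw [map_sub, HahnSeries.orderTop_sub, hf]
  simpa [hf, hg] using h

theorem sub_of_gt (hf : HasOrdA f k) (hg : HasOrdA g l) (h : l < k) : HasOrdA (f - g) l := by
  simpa using (hg.sub_of_lt hf h).neg

theorem neg_one_pow (m : ℕ) : HasOrdA ((-1) ^ m) 0 := by
  rcases neg_one_pow_eq_or (RatFunc ℚ) m with h | h <;> rw [h]
  exacts [one, one.neg]

theorem Aq_pow (m : ℕ) : HasOrdA (Aq ^ m) m := by
  simp [iff_orderTop, Aq]

theorem Aq_zpow (k : ℤ) : HasOrdA (Aq ^ k) k := by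
  obtain ⟨m, rfl | rfl⟩ := k.eq_nat_or_neg
  · simpa using Aq_pow m
  · simpa using (Aq_pow m).inv

theorem one_sub_Aq_pow {m : ℕ} (hm : 0 < m) : HasOrdA (1 - Aq ^ m) 0 :=
  one.sub_of_lt (Aq_pow m) (by exact_mod_cast hm)

theorem poch (m : ℕ) : HasOrdA (poch m) 0 := by
  unfold _root_.poch
  induction m with
  | zero => simpa using one
  | succ m ih =>
    rw [Finset.prod_range_succ, ← pow_succ', ← pow_mul]
    exact ih.mul (one_sub_Aq_pow (by positivity))

theorem Delta (m : ℕ) : HasOrdA (Delta m) (-(2 * (m : ℤ))) := by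
  have h := ((neg_one_pow m).mul ((Aq_zpow (2 * ((m : ℤ) + 1))).sub_of_gt
    (Aq_zpow (-(2 * ((m : ℤ) + 1)))) (by lia))).div
    ((Aq_zpow 2).sub_of_gt (Aq_zpow (-2)) (by lia))
  exact ⟨h.1, h.2.trans (by ring)⟩

theorem theta (a b c : ℕ) : HasOrdA (theta a b c)
    (-(2 * (((a + b - c) / 2 + (a + c - b) / 2 + (b + c - a) / 2 : ℕ) : ℤ))) := by
  have h (x y z : ℕ) := (((neg_one_pow (x + y + z)).mul
    (Aq_zpow (-(2 * ((x + y + z : ℕ) : ℤ))))).mul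
    ((((poch x).mul (poch y)).mul (poch z)).mul (poch (x + y + z + 1)))).div
    ((((one_sub_Aq_pow four_pos).mul (poch (x + y))).mul (poch (y + z))).mul (poch (x + z)))
  have h' := h ((a + b - c) / 2) ((a + c - b) / 2) ((b + c - a) / 2)
  exact ⟨h'.1, h'.2.trans (by ring)⟩

end HasOrdA

/-- `Δ_{2j}/θ(n,n,2j)` is nonzero, of order `2(n-j)` at `A = 0`, for `0 ≤ j ≤ n`. -/
theorem delta_div_theta_ne_zero_and_order (n j : ℕ) (hjn : j ≤ n) :
    Delta (2 * j) / theta n n (2 * j) ≠ 0 ∧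
      ordA (Delta (2 * j) / theta n n (2 * j)) = 2 * (n : ℤ) - 2 * (j : ℤ) := by
  have h := (HasOrdA.Delta (2 * j)).div (HasOrdA.theta n n (2 * j))
  exact ⟨h.1, h.2.trans (by lia)⟩

end
end

section
/- For integers 1 ≤ j ≤ n, the order at A = 0 of Δ_{2j}/θ(n,n,2j) satisfies m(Δ_{2j}/θ(n,n,2j)) = m(Δ_{2(j−1)}/θ(n,n,2(j−1))) − 2. -/
noncomputable section

namespace HasOrdA

variable {f g : RatFunc ℚ} {k l : ℤ}

theorem neg_one_pow_mul (hf : HasOrdA f k) (m : ℕ) : HasOrdA ((-1) ^ m * f) k := by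
  rcases neg_one_pow_eq_or (RatFunc ℚ) m with h | h <;> rw [h]
  · simpa using hf
  · simpa using hf.neg

theorem prod {ι : Type*} {s : Finset ι} {F : ι → RatFunc ℚ}
    (hF : ∀ i ∈ s, HasOrdA (F i) 0) : HasOrdA (∏ i ∈ s, F i) 0 :=
  Finset.prod_induction F (HasOrdA · 0) (fun _ _ ha hb => by simpa using ha.mul hb) one hF

end HasOrdA

theorem Aq_ne_zero : Aq ≠ 0 := RatFunc.X_ne_zero

theorem hasOrdA_Aq_pow (m : ℕ) : HasOrdA (Aq ^ m) m :=
  ⟨pow_ne_zero _ Aq_ne_zero, by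
    unfold ordA Aq
    rw [map_pow, RatFunc.coe_X, HahnSeries.order_pow, HahnSeries.order_single one_ne_zero]
    simp⟩

theorem hasOrdA_Aq_zpow (k : ℤ) : HasOrdA (Aq ^ k) k := by
  obtain ⟨m, rfl | rfl⟩ := k.eq_nat_or_neg
  · simpa using hasOrdA_Aq_pow m
  · simpa using (hasOrdA_Aq_pow m).inv

theorem hasOrdA_one_sub_Aq_pow {m : ℕ} (hm : 0 < m) : HasOrdA (1 - Aq ^ m) 0 := by
  have hcoe : ((1 - Aq ^ m : RatFunc ℚ) : LaurentSeries ℚ) =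
      1 - HahnSeries.single (m : ℤ) 1 := by
    rw [map_sub, map_one, map_pow, Aq, RatFunc.coe_X, HahnSeries.single_pow]
    simp
  have hcoeff : (1 - HahnSeries.single (m : ℤ) 1 : LaurentSeries ℚ).coeff 0 ≠ 0 := by
    rw [HahnSeries.coeff_sub, HahnSeries.coeff_single_of_ne (by omega)]
    simp
  have hne : (1 - HahnSeries.single (m : ℤ) 1 : LaurentSeries ℚ) ≠ 0 := by
    intro h
    simp [h] at hcoeff
  refine ⟨fun h => hne (by rw [← hcoe, h, map_zero]), ?_⟩
  rw [ordA, hcoe]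
  refine le_antisymm (HahnSeries.order_le_of_coeff_ne_zero hcoeff)
    ((HahnSeries.le_order_iff_forall hne).2 fun i hi => ?_)
  rw [HahnSeries.coeff_sub, HahnSeries.coeff_single_of_ne (by omega), HahnSeries.coeff_one,
    if_neg hi.ne, sub_zero]

theorem hasOrdA_poch (m : ℕ) : HasOrdA (poch m) 0 :=
  HasOrdA.prod fun j _ => by
    rw [← pow_mul, ← pow_add]
    exact hasOrdA_one_sub_Aq_pow (by omega)

theorem hasOrdA_Aq_zpow_sub_zpow_neg {m : ℕ} (hm : 0 < m) :
    HasOrdA (Aq ^ (m : ℤ) - Aq ^ (-(m : ℤ))) (-m) := by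
  have h : Aq ^ (m : ℤ) - Aq ^ (-(m : ℤ)) = -(Aq ^ (-(m : ℤ)) * (1 - Aq ^ (2 * m))) := by
    have := pow_ne_zero m Aq_ne_zero
    rw [zpow_neg, zpow_natCast]
    field_simp
    ring
  rw [h]
  simpa using ((hasOrdA_Aq_zpow (-m)).mul (hasOrdA_one_sub_Aq_pow (m := 2 * m) (by omega))).neg

theorem hasOrdA_Delta (m : ℕ) : HasOrdA (Delta m) (-(2 * m)) := by
  have hnum := hasOrdA_Aq_zpow_sub_zpow_neg (m := 2 * (m + 1)) (by omega)
  have hden := hasOrdA_Aq_zpow_sub_zpow_neg (m := 2) (by omega)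
  have h := (hnum.neg_one_pow_mul m).div hden
  push_cast at h
  unfold Delta
  convert h using 1
  ring

theorem hasOrdA_theta (a b c : ℕ) :
    HasOrdA (theta a b c)
      (-(2 * (((a + b - c) / 2 + (a + c - b) / 2 + (b + c - a) / 2 : ℕ) : ℤ))) := by
  have hp := hasOrdA_poch
  have h14 : HasOrdA (1 - Aq ^ 4) 0 := hasOrdA_one_sub_Aq_pow (by omega)
  have h := fun k x y z w u v t => (((hasOrdA_Aq_zpow k).neg_one_pow_mul x).mul
    ((((hp y).mul (hp z)).mul (hp w)).mul (hp u))).div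
      (((h14.mul (hp v)).mul (hp t)).mul (hp (y + w)))
  simp only [add_zero, sub_zero] at h
  exact h _ _ _ _ _ _ _ _

theorem ordA_Delta_div_theta {n j : ℕ} (hjn : j ≤ n) :
    ordA (Delta (2 * j) / theta n n (2 * j)) = 2 * n - 2 * j := by
  rw [((hasOrdA_Delta (2 * j)).div (hasOrdA_theta n n (2 * j))).2]
  omega

/-- `m(Δ_{2j}/θ(n,n,2j)) = m(Δ_{2(j-1)}/θ(n,n,2(j-1))) - 2` for `1 ≤ j ≤ n`. -/
theorem delta_div_theta_order_step (n j : ℕ) (hj : 1 ≤ j) (hjn : j ≤ n) :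
    ordA (Delta (2 * j) / theta n n (2 * j)) =
      ordA (Delta (2 * (j - 1)) / theta n n (2 * (j - 1))) - 2 := by
  rw [ordA_Delta_div_theta hjn, ordA_Delta_div_theta (by omega : j - 1 ≤ n)]
  omega

end
end

section
/- Let k ≥ 1 and 0 ≤ p ≤ j ≤ n be integers. Then in ℚ(A): C_{n,j} · (Δ_{2p}/θ(j,j,2p)) · (μ_{2p}^{n,n})^{k−1} = (−1)^{kn − j − n + 2p − kp} · A^{2j + 2j² − 2n − 4jn + 2kn + kn² − 2kp + 2p² − 2kp²} · (A^4;A^4)_j (A^4;A^4)_n (A^4;A^4)_{1+2p} / ((A^4;A^4)_{n−j} (A^4;A^4)_{j−p} (A^4;A^4)_{1+j+p} ((A^4;A^4)_p)²). -/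
noncomputable section

/-- `A` is not a root of unity. -/
theorem one_sub_Aq_pow_ne_zero {m : ℕ} (hm : m ≠ 0) : 1 - Aq ^ m ≠ 0 := by
  intro h
  have hpoly : (Polynomial.X : Polynomial ℚ) ^ m = 1 := by
    apply RatFunc.algebraMap_injective ℚ
    simpa [Aq] using (sub_eq_zero.mp h).symm
  have hdeg := congrArg Polynomial.natDegree hpoly
  simp at hdeg
  exact hm hdeg

theorem poch_ne_zero (m : ℕ) : poch m ≠ 0 := by
  refine Finset.prod_ne_zero_iff.mpr fun i _ => ?_
  rw [← pow_mul, ← pow_add]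
  exact one_sub_Aq_pow_ne_zero (by omega)

theorem poch_succ (m : ℕ) : poch (m + 1) = poch m * (1 - Aq ^ 4 * (Aq ^ 4) ^ m) :=
  Finset.prod_range_succ _ _

/-- `Δ_{2p} = A^{-4p} (1 - A^{4(2p+1)}) / (1 - A^4)`, in terms of Pochhammer symbols. -/
theorem Delta_two_mul (p : ℕ) :
    Delta (2 * p) = Aq ^ (-(4 * (p : ℤ))) * poch (1 + 2 * p) / ((1 - Aq ^ 4) * poch (2 * p)) := by
  have hA := Aq_ne_zero
  have hP := poch_ne_zero (2 * p)
  have hA4 : 1 - Aq ^ 4 ≠ 0 := one_sub_Aq_pow_ne_zero (by norm_num)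
  have hden : Aq ^ (2 : ℤ) - Aq ^ (-2 : ℤ) = -(Aq ^ (-2 : ℤ) * (1 - Aq ^ 4)) := by
    rw [mul_sub, ← zpow_natCast Aq 4, ← zpow_add₀ hA]
    norm_num
  have hnum : Aq ^ (2 * (((2 * p : ℕ) : ℤ) + 1)) - Aq ^ (-(2 * (((2 * p : ℕ) : ℤ) + 1))) =
      -(Aq ^ (-2 : ℤ) * Aq ^ (-(4 * (p : ℤ))) * (1 - Aq ^ 4 * (Aq ^ 4) ^ (2 * p))) := by
    rw [← pow_mul, ← pow_add, mul_sub, ← zpow_natCast Aq (4 + 4 * (2 * p)), ← zpow_add₀ hA,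
      ← zpow_add₀ hA, mul_one, neg_sub]
    congr 2 <;> push_cast <;> ring
  have hA2 : Aq ^ (-2 : ℤ) ≠ 0 := zpow_ne_zero _ hA
  rw [Delta, hden, hnum, add_comm 1, poch_succ, (even_two_mul p).neg_one_pow]
  generalize Aq ^ (-2 : ℤ) = a at *
  generalize Aq ^ (-(4 * (p : ℤ))) = b at *
  field_simp

theorem theta_self_self_two_mul {j p : ℕ} (hpj : p ≤ j) :
    theta j j (2 * p) = (-1) ^ (j + p) * Aq ^ (-(2 * ((j : ℤ) + p))) *
      (poch (j - p) * poch p ^ 2 * poch (1 + j + p)) /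
        ((1 - Aq ^ 4) * poch j ^ 2 * poch (2 * p)) := by
  have hx : (j + j - 2 * p) / 2 = j - p := by omega
  have hy : (j + 2 * p - j) / 2 = p := by omega
  have hj : j - p + p = j := by omega
  rw [theta, hx, hy, hj, ← two_mul p, add_comm (j + p) 1, ← add_assoc 1 j p]
  push_cast
  ring

/-- Explicit formula for `C_{n,j} · (Δ_{2p}/θ(j,j,2p)) · (μ_{2p}^{n,n})^{k-1}` in `ℚ(A)`. -/
theorem coefficient_formula (n j p k : ℕ) (hk : 1 ≤ k) (hpj : p ≤ j) (hjn : j ≤ n) :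
    Cnn n j * (Delta (2 * p) / theta j j (2 * p)) * (mu n p) ^ (k - 1) =
      (-1 : RatFunc ℚ) ^ ((k : ℤ) * n - j - n + 2 * p - k * p) *
        Aq ^ (2 * (j : ℤ) + 2 * (j : ℤ) ^ 2 - 2 * (n : ℤ) - 4 * (j : ℤ) * n + 2 * (k : ℤ) * n +
          (k : ℤ) * (n : ℤ) ^ 2 - 2 * (k : ℤ) * p + 2 * (p : ℤ) ^ 2 - 2 * (k : ℤ) * (p : ℤ) ^ 2) *
        (poch j * poch n * poch (1 + 2 * p)) /
        (poch (n - j) * poch (j - p) * poch (1 + j + p) * (poch p) ^ 2) := by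
  have hA := Aq_ne_zero
  have hsign : (-1 : RatFunc ℚ) ^ ((k : ℤ) * n - j - n + 2 * p - k * p) =
      (-1) ^ (j + p) * ((-1) ^ (n - p)) ^ (k - 1) := by
    have hexp : (k : ℤ) * n - j - n + 2 * p - k * p =
        ((j + p + (n - p) * (k - 1) : ℕ) : ℤ) - 2 * (j : ℤ) := by
      push_cast [Nat.cast_sub hk, Nat.cast_sub (hpj.trans hjn)]
      ring
    rw [hexp, zpow_sub₀ (by norm_num), zpow_natCast, zpow_mul, ← pow_mul, pow_add]
    norm_num
  have hpow : Aq ^ (2 * (j : ℤ) + 2 * (j : ℤ) ^ 2 - 2 * (n : ℤ) - 4 * (j : ℤ) * n +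
        2 * (k : ℤ) * n + (k : ℤ) * (n : ℤ) ^ 2 - 2 * (k : ℤ) * p + 2 * (p : ℤ) ^ 2 -
        2 * (k : ℤ) * (p : ℤ) ^ 2) * Aq ^ (-(2 * ((j : ℤ) + p))) =
      Aq ^ ((n : ℤ) ^ 2 + 2 * (j : ℤ) ^ 2 - 4 * (j : ℤ) * n) * Aq ^ (-(4 * (p : ℤ))) *
        (Aq ^ (2 * (n : ℤ) - 2 * p + (n : ℤ) ^ 2 - 2 * (p : ℤ) ^ 2)) ^ (k - 1) := by
    rw [← zpow_natCast (Aq ^ _) (k - 1), ← zpow_mul, ← zpow_add₀ hA, ← zpow_add₀ hA,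
      ← zpow_add₀ hA]
    congr 1
    push_cast [Nat.cast_sub hk]
    ring
  have hB : Aq ^ (-(2 * ((j : ℤ) + p))) ≠ 0 := zpow_ne_zero _ hA
  have hs : ((-1 : RatFunc ℚ) ^ (j + p)) ^ 2 = 1 := by rw [← pow_mul, mul_comm, pow_mul]; simp
  have hs0 : (-1 : RatFunc ℚ) ^ (j + p) ≠ 0 := pow_ne_zero _ (by norm_num)
  rw [eq_div_of_mul_eq hB hpow, hsign, Delta_two_mul, theta_self_self_two_mul hpj, Cnn, mu,
    mul_pow]
  have hA4 : 1 - Aq ^ 4 ≠ 0 := one_sub_Aq_pow_ne_zero (by norm_num)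
  have hj := poch_ne_zero j
  have hnj := poch_ne_zero (n - j)
  have hjp := poch_ne_zero (j - p)
  have hp := poch_ne_zero p
  have hp2 := poch_ne_zero (2 * p)
  have hjp1 := poch_ne_zero (1 + j + p)
  generalize (-1 : RatFunc ℚ) ^ (j + p) = s at *
  generalize ((-1 : RatFunc ℚ) ^ (n - p)) ^ (k - 1) = t
  generalize Aq ^ (-(2 * ((j : ℤ) + p))) = b at *
  generalize Aq ^ (-(4 * (p : ℤ))) = c
  generalize Aq ^ ((n : ℤ) ^ 2 + 2 * (j : ℤ) ^ 2 - 4 * (j : ℤ) * n) = d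
  generalize (Aq ^ (2 * (n : ℤ) - 2 * p + (n : ℤ) ^ 2 - 2 * (p : ℤ) ^ 2)) ^ (k - 1) = e
  generalize 1 - Aq ^ 4 = f at *
  field_simp
  simp [hs]

end
end

section
/- Let k ≥ 1 and 0 ≤ p ≤ j ≤ n be integers. Then the rational function C_{n,j} · (Δ_{2p}/θ(j,j,2p)) · (μ_{2p}^{n,n})^{k−1} is nonzero and its order at A = 0 equals 2j + 2j² − 2n − 4jn + 2kn + kn² − 2kp + 2p² − 2kp². -/
noncomputable section

/-- `f` is a nonzero rational function of order `m` at `A = 0`. -/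
def HasOrder (f : RatFunc ℚ) (m : ℤ) : Prop := f ≠ 0 ∧ ordA f = m

namespace HasOrder

variable {f g : RatFunc ℚ} {a b : ℤ}

theorem mul (hf : HasOrder f a) (hg : HasOrder g b) : HasOrder (f * g) (a + b) := by
  refine ⟨mul_ne_zero hf.1 hg.1, ?_⟩
  rw [← hf.2, ← hg.2, ordA, map_mul]
  exact HahnSeries.order_mul ((map_ne_zero _).2 hf.1) ((map_ne_zero _).2 hg.1)

theorem one : HasOrder 1 0 := ⟨one_ne_zero, by rw [ordA, map_one, HahnSeries.order_one]⟩

theorem inv (hf : HasOrder f a) : HasOrder f⁻¹ (-a) := by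
  have hmul := (mul hf ⟨inv_ne_zero hf.1, rfl⟩).2
  rw [mul_inv_cancel₀ hf.1, one.2] at hmul
  exact ⟨inv_ne_zero hf.1, by lia⟩

theorem div (hf : HasOrder f a) (hg : HasOrder g b) : HasOrder (f / g) (a - b) := by
  rw [div_eq_mul_inv, sub_eq_add_neg]
  exact hf.mul hg.inv

theorem pow (hf : HasOrder f a) (n : ℕ) : HasOrder (f ^ n) (n * a) := by
  refine ⟨pow_ne_zero n hf.1, ?_⟩
  rw [← hf.2, ordA, map_pow, HahnSeries.order_pow, nsmul_eq_mul, ordA]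

theorem neg (hf : HasOrder f a) : HasOrder (-f) a := by
  refine ⟨neg_ne_zero.2 hf.1, ?_⟩
  rw [← hf.2, ordA, map_neg, HahnSeries.order_neg, ordA]

theorem neg_one_pow (n : ℕ) : HasOrder ((-1) ^ n) 0 := by
  simpa using one.neg.pow n

theorem Aq_zpow (m : ℤ) : HasOrder (Aq ^ m) m := by
  refine ⟨zpow_ne_zero m RatFunc.X_ne_zero, ?_⟩
  rw [ordA, map_zpow₀, Aq, RatFunc.coe_X, ← RatFunc.single_zpow,
    HahnSeries.order_single one_ne_zero]

theorem one_sub_Aq_pow {m : ℕ} (hm : 0 < m) : HasOrder (1 - Aq ^ m) 0 := by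
  have hcoe : ((1 - Aq ^ m : RatFunc ℚ) : LaurentSeries ℚ) =
      1 - HahnSeries.single (m : ℤ) (1 : ℚ) := by
    rw [map_sub, map_one, map_pow, Aq, RatFunc.coe_X, RatFunc.single_one_eq_pow]
  have htop : (1 - HahnSeries.single (m : ℤ) (1 : ℚ) : LaurentSeries ℚ).orderTop = 0 := by
    rw [HahnSeries.orderTop_sub, HahnSeries.orderTop_one]
    rw [HahnSeries.orderTop_one, HahnSeries.orderTop_single one_ne_zero]
    exact_mod_cast hm
  have hne : (1 - HahnSeries.single (m : ℤ) (1 : ℚ) : LaurentSeries ℚ) ≠ 0 := by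
    intro h
    simp [h] at htop
  refine ⟨fun h => hne ?_, ?_⟩
  · rw [← hcoe, h, map_zero]
  · rw [ordA, hcoe]
    have := HahnSeries.order_eq_orderTop_of_ne_zero hne
    rw [htop] at this
    exact_mod_cast this

theorem poch (m : ℕ) : HasOrder (poch m) 0 := by
  induction m with
  | zero => simpa [_root_.poch] using one
  | succ m ih =>
    rw [_root_.poch, Finset.prod_range_succ, ← _root_.poch, ← pow_mul, ← pow_add]
    simpa using ih.mul (one_sub_Aq_pow (m := 4 + 4 * m) (by lia))

theorem Aq_zpow_sub_zpow_neg {m : ℕ} (hm : 0 < m) :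
    HasOrder (Aq ^ (m : ℤ) - Aq ^ (-(m : ℤ))) (-m) := by
  have hA : Aq ≠ 0 := RatFunc.X_ne_zero
  have hfactor : Aq ^ (m : ℤ) - Aq ^ (-(m : ℤ)) =
      -(Aq ^ (-(m : ℤ)) * (1 - Aq ^ (2 * m))) := by
    rw [zpow_neg, zpow_natCast]
    field_simp
    ring
  rw [hfactor]
  simpa using ((Aq_zpow (-m)).mul (one_sub_Aq_pow (m := 2 * m) (by lia))).neg

theorem Delta (m : ℕ) : HasOrder (Delta m) (-(2 * m)) := by
  have hnum := Aq_zpow_sub_zpow_neg (m := 2 * (m + 1)) (by lia)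
  have hden := Aq_zpow_sub_zpow_neg (m := 2) (by lia)
  push_cast at hnum hden
  rw [_root_.Delta]
  convert ((neg_one_pow m).mul hnum).div hden using 1
  ring

theorem theta (a b c : ℕ) :
    HasOrder (theta a b c)
      (-(2 * (((a + b - c) / 2 + (a + c - b) / 2 + (b + c - a) / 2 : ℕ) : ℤ))) := by
  rw [_root_.theta]
  simpa only [zero_add, add_zero, sub_zero] using
    (((neg_one_pow _).mul (Aq_zpow _)).mul
      ((((poch _).mul (poch _)).mul (poch _)).mul (poch _))).div
      ((((one_sub_Aq_pow (by lia : 0 < 4)).mul (poch _)).mul (poch _)).mul (poch _))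

theorem mu (n j : ℕ) :
    HasOrder (mu n j) (2 * (n : ℤ) - 2 * j + (n : ℤ) ^ 2 - 2 * (j : ℤ) ^ 2) := by
  rw [_root_.mu]
  simpa only [zero_add] using (neg_one_pow (n - j)).mul (Aq_zpow _)

theorem Cnn (n i : ℕ) :
    HasOrder (Cnn n i) ((n : ℤ) ^ 2 + 2 * (i : ℤ) ^ 2 - 4 * (i : ℤ) * n) := by
  rw [_root_.Cnn]
  simpa only [add_zero, sub_zero] using
    ((Aq_zpow _).mul (poch n)).div ((poch i).mul (poch (n - i)))

end HasOrder

/-- `C_{n,j} · (Δ_{2p}/θ(j,j,2p)) · (μ_{2p}^{n,n})^{k-1}` is nonzero, of order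
`2j + 2j² - 2n - 4jn + 2kn + kn² - 2kp + 2p² - 2kp²` at `A = 0`. -/
theorem coefficient_ne_zero_and_order (n j p k : ℕ) (hk : 1 ≤ k) (hpj : p ≤ j) (hjn : j ≤ n) :
    Cnn n j * (Delta (2 * p) / theta j j (2 * p)) * (mu n p) ^ (k - 1) ≠ 0 ∧
      ordA (Cnn n j * (Delta (2 * p) / theta j j (2 * p)) * (mu n p) ^ (k - 1)) =
        2 * (j : ℤ) + 2 * (j : ℤ) ^ 2 - 2 * (n : ℤ) - 4 * (j : ℤ) * n + 2 * (k : ℤ) * n +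
          (k : ℤ) * (n : ℤ) ^ 2 - 2 * (k : ℤ) * p + 2 * (p : ℤ) ^ 2 -
          2 * (k : ℤ) * (p : ℤ) ^ 2 := by
  have hord := ((HasOrder.Cnn n j).mul
    ((HasOrder.Delta (2 * p)).div (HasOrder.theta j j (2 * p)))).mul
    ((HasOrder.mu n p).pow (k - 1))
  have hsum : (j + j - 2 * p) / 2 + (j + 2 * p - j) / 2 + (j + 2 * p - j) / 2 = j + p := by lia
  refine ⟨hord.1, hord.2.trans ?_⟩
  rw [hsum]
  push_cast [hk]
  ring

end
end
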